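/- Let 1 ≤ n ≤ N and let a_1, …, a_N be vectors in ℝ^d. Set U = Σ_{i=1}^N a_i and Û = (N/n)·Σ_{i∈τ} a_i, where τ is a uniform random n-subset of {1, …, N}. Then E_τ |U − Û|² ≤ 2·((N−n)/n)·Σ_{i=1}^N |a_i|². -/

import Mathlib

open Finset

/-- The number of `n`-subsets of `α` containing a given point is `n / |α|` times the number of all
`n`-subsets. -/
lemma card_mul_card_filter_mem_powersetCard {α : Type*} [Fintype α] [DecidableEq α] {n : ℕ}
    (hn : 1 ≤ n) (i : α) :
    (Fintype.card α : ℝ) * #{s ∈ powersetCard n (univ : Finset α) | i ∈ s}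
      = n * (Fintype.card α).choose n := by
  have h := card_filter_powersetCard_subset {i} univ n (subset_univ _) (by simpa using hn)
  simp only [singleton_subset_iff, card_singleton, card_univ] at h
  rw [h]
  obtain ⟨m, rfl⟩ := Nat.exists_eq_add_of_le' hn
  obtain ⟨k, hk⟩ := Nat.exists_eq_add_of_le' (Fintype.card_pos_iff.2 ⟨i⟩ : 1 ≤ Fintype.card α)
  rw [hk]
  have := Nat.add_one_mul_choose_eq k m
  simp only [Nat.add_sub_cancel]
  rw [mul_comm ((m + 1 : ℕ) : ℝ)]
  exact_mod_cast this

/-- The number of `n`-subsets of `α` containing two given distinct points is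
`n (n - 1) / (|α| (|α| - 1))` times the number of all `n`-subsets. -/
lemma card_mul_card_filter_mem_mem_powersetCard {α : Type*} [Fintype α] [DecidableEq α] {n : ℕ}
    (hn : 1 ≤ n) {i j : α} (hij : i ≠ j) :
    (Fintype.card α : ℝ) * (Fintype.card α - 1) *
        #{s ∈ powersetCard n (univ : Finset α) | i ∈ s ∧ j ∈ s}
      = n * (n - 1) * (Fintype.card α).choose n := by
  obtain rfl | hn2 := hn.eq_or_lt
  · have : ({s ∈ powersetCard 1 (univ : Finset α) | i ∈ s ∧ j ∈ s} : Finset (Finset α)) = ∅ := by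
      refine filter_eq_empty_iff.2 fun s hs h ↦ hij ?_
      exact card_le_one.1 (mem_powersetCard.1 hs).2.le i h.1 j h.2
    simp [this]
  have h := card_filter_powersetCard_subset {i, j} univ n (subset_univ _)
    (by rw [card_pair hij]; exact hn2)
  simp only [insert_subset_iff, singleton_subset_iff, card_pair hij, card_univ] at h
  rw [h]
  obtain ⟨m, rfl⟩ := Nat.exists_eq_add_of_le' (hn2 : 2 ≤ n)
  have hcard : 2 ≤ Fintype.card α := card_pair hij ▸ card_le_univ {i, j}
  obtain ⟨k, hk⟩ := Nat.exists_eq_add_of_le' hcard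
  rw [hk]
  have h1 : ((k : ℝ) + 1) * k.choose m = (k + 1).choose (m + 1) * (m + 1) := by
    exact_mod_cast Nat.add_one_mul_choose_eq k m
  have h2 : ((k : ℝ) + 2) * (k + 1).choose (m + 1) = (k + 2).choose (m + 2) * (m + 2) := by
    exact_mod_cast Nat.add_one_mul_choose_eq (k + 1) (m + 1)
  simp only [Nat.add_sub_cancel]
  push_cast
  linear_combination ((k : ℝ) + 2) * h1 + (m + 1) * h2

section

variable {α E : Type*} [Fintype α] [NormedAddCommGroup E] [InnerProductSpace ℝ E]

/-- First moment of the sum of a family of vectors over a random `n`-subset. -/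
lemma card_smul_sum_powersetCard_sum {n : ℕ} (hn : 1 ≤ n) (a : α → E) :
    (Fintype.card α : ℝ) • ∑ s ∈ powersetCard n (univ : Finset α), ∑ i ∈ s, a i
      = (n * (Fintype.card α).choose n : ℝ) • ∑ i, a i := by
  classical
  have h (s : Finset α) : ∑ i ∈ s, a i = ∑ i, if i ∈ s then a i else 0 := by simp
  rw [sum_congr rfl fun s _ ↦ h s, sum_comm, smul_sum, smul_sum]
  refine sum_congr rfl fun i _ ↦ ?_
  rw [← sum_filter, sum_const, ← Nat.cast_smul_eq_nsmul ℝ, smul_smul,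
    card_mul_card_filter_mem_powersetCard hn]

/-- Second moment of the sum of a family of vectors over a random `n`-subset. -/
lemma card_mul_sum_powersetCard_norm_sum_sq {n : ℕ} (hn : 1 ≤ n) (a : α → E) :
    (Fintype.card α : ℝ) * (Fintype.card α - 1) *
        ∑ s ∈ powersetCard n (univ : Finset α), ‖∑ i ∈ s, a i‖ ^ 2
      = n * (Fintype.card α).choose n *
        ((n - 1) * ‖∑ i, a i‖ ^ 2 + (Fintype.card α - n) * ∑ i, ‖a i‖ ^ 2) := by
  classical
  have h (s : Finset α) : ‖∑ i ∈ s, a i‖ ^ 2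
      = ∑ i, ∑ j, if i ∈ s ∧ j ∈ s then inner ℝ (a i) (a j) else 0 := by
    simp_rw [← real_inner_self_eq_norm_sq, sum_inner, inner_sum]
    simp [ite_and]
  have hpair (i j : α) : (Fintype.card α : ℝ) * (Fintype.card α - 1) *
      ∑ s ∈ powersetCard n (univ : Finset α), (if i ∈ s ∧ j ∈ s then inner ℝ (a i) (a j) else 0)
      = n * (Fintype.card α).choose n * ((n - 1) * inner ℝ (a i) (a j)
        + if i = j then (Fintype.card α - n) * ‖a i‖ ^ 2 else 0) := by
    rw [← sum_filter, sum_const, nsmul_eq_mul]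
    split_ifs with hij
    · subst hij
      have := card_mul_card_filter_mem_powersetCard hn i
      simp only [and_self, real_inner_self_eq_norm_sq]
      linear_combination ((Fintype.card α : ℝ) - 1) * ‖a i‖ ^ 2 * this
    · linear_combination inner ℝ (a i) (a j) * card_mul_card_filter_mem_mem_powersetCard hn hij
  have hU : ‖∑ i, a i‖ ^ 2 = ∑ i, ∑ j, inner ℝ (a i) (a j) := by
    simp_rw [← real_inner_self_eq_norm_sq, sum_inner, inner_sum]
  rw [sum_congr rfl fun s _ ↦ h s, sum_comm, mul_sum, hU, mul_sum, mul_sum, ← sum_add_distrib, mul_sum]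
  refine sum_congr rfl fun i _ ↦ ?_
  rw [sum_comm, mul_sum]
  simp_rw [hpair]
  rw [← mul_sum, sum_add_distrib, ← mul_sum]
  simp

/-- Exact second moment of the error of the subsampled estimator of `∑ i, a i`. -/
lemma sum_powersetCard_norm_sum_sub_smul_sum_sq {n : ℕ} (hn : 1 ≤ n)
    (hα : 2 ≤ Fintype.card α) (a : α → E) :
    ∑ s ∈ powersetCard n (univ : Finset α),
        ‖(∑ i, a i) - ((Fintype.card α : ℝ) / n) • ∑ i ∈ s, a i‖ ^ 2
      = (Fintype.card α).choose n * ((Fintype.card α - n) / (n * (Fintype.card α - 1))) *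
        (Fintype.card α * ∑ i, ‖a i‖ ^ 2 - ‖∑ i, a i‖ ^ 2) := by
  have h1 := congrArg (inner ℝ (∑ i, a i)) (card_smul_sum_powersetCard_sum hn a)
  rw [real_inner_smul_right, real_inner_smul_right, real_inner_self_eq_norm_sq, inner_sum] at h1
  have h2 := card_mul_sum_powersetCard_norm_sum_sq hn a
  simp_rw [norm_sub_sq_real, real_inner_smul_right, norm_smul, mul_pow, Real.norm_eq_abs, sq_abs]
  rw [sum_add_distrib, sum_sub_distrib, ← mul_sum, ← mul_sum, ← mul_sum, sum_const,
    card_powersetCard, card_univ, nsmul_eq_mul]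
  have hN : (2 : ℝ) ≤ Fintype.card α := by exact_mod_cast hα
  have hN0 : (Fintype.card α : ℝ) ≠ 0 := by positivity
  have hN1 : (Fintype.card α : ℝ) - 1 ≠ 0 := by linarith
  have hn0 : (n : ℝ) ≠ 0 := by positivity
  rw [mul_comm, ← eq_div_iff hN0] at h1
  rw [mul_comm, ← eq_div_iff (mul_ne_zero hN0 hN1)] at h2
  rw [h1, h2]
  field_simp
  ring

end

/-- Second moment of the error of the subsampled estimator: with `U = ∑ aᵢ` and
`Û = (N/n)·∑_{i∈τ} aᵢ` for a uniform random `n`-subset `τ` of `{1, …, N}` (modelled as the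
average over all `n`-element subsets of `Fin N`),
`E_τ |U − Û|² ≤ 2·((N−n)/n)·∑ |aᵢ|²`. -/
theorem subsampled_sum_second_moment
    (N n d : ℕ) (hn1 : 1 ≤ n) (hnN : n ≤ N) (a : Fin N → EuclideanSpace ℝ (Fin d)) :
    (N.choose n : ℝ)⁻¹ *
        ∑ s ∈ Finset.powersetCard n (Finset.univ : Finset (Fin N)),
          ‖(∑ i, a i) - ((N : ℝ) / n) • ∑ i ∈ s, a i‖ ^ 2
      ≤ 2 * (((N : ℝ) - n) / n) * ∑ i, ‖a i‖ ^ 2 := by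
  rcases (hn1.trans hnN).eq_or_lt with rfl | hN
  · obtain rfl : n = 1 := le_antisymm hnN hn1
    simp [powersetCard_one]
  have h := sum_powersetCard_norm_sum_sub_smul_sum_sq hn1 (by rw [Fintype.card_fin]; exact hN) a
  rw [Fintype.card_fin] at h
  have hchoose : (N.choose n : ℝ) ≠ 0 := by exact_mod_cast (Nat.choose_pos hnN).ne'
  rw [h, mul_assoc, inv_mul_cancel_left₀ hchoose]
  have hN' : (2 : ℝ) ≤ N := by exact_mod_cast hN
  have hN1 : (0 : ℝ) < N - 1 := by linarith
  have hn' : (0 : ℝ) < n := by exact_mod_cast hn1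
  have hnN' : (0 : ℝ) ≤ N - n := sub_nonneg.2 (by exact_mod_cast hnN)
  have hS : 0 ≤ ∑ i, ‖a i‖ ^ 2 := by positivity
  calc ((N : ℝ) - n) / (n * (N - 1)) * (N * ∑ i, ‖a i‖ ^ 2 - ‖∑ i, a i‖ ^ 2)
      ≤ ((N : ℝ) - n) / (n * (N - 1)) * (2 * (N - 1) * ∑ i, ‖a i‖ ^ 2) := by
        gcongr
        nlinarith [sq_nonneg ‖∑ i, a i‖]
    _ = 2 * (((N : ℝ) - n) / n) * ∑ i, ‖a i‖ ^ 2 := by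
        field_simp
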